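/- arXiv:math/0301336 — 2 statements merged into one kernel-verified Lean document; each statement's English description precedes it below -/
import Mathlib

section
/- Let k ≥ 1. Every maximal (proper) ideal of the commutative Banach algebra A_k(𝔻²) is of the form N_{λ,μ} = { f ∈ A_k(𝔻²) : f(λ, μ) = 0 } for some point (λ, μ) in the closed bidisk. -/
noncomputable section

/-- The closed bidisk `{(z,w) : ‖z‖ ≤ 1, ‖w‖ ≤ 1}` in `ℂ²`. -/
def Bidisk : Set (ℂ × ℂ) := Metric.closedBall 0 1 ×ˢ Metric.closedBall 0 1

instance : CompactSpace Bidisk :=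
  isCompact_iff_compactSpace.mp ((isCompact_closedBall _ _).prod (isCompact_closedBall _ _))

/-- `g` has the two-variable power series expansion with coefficients `a`,
converging at every point of the open bidisk. -/
def HasCoeffsAt (g : Bidisk → ℂ) (a : ℕ → ℕ → ℂ) : Prop :=
  ∀ p : Bidisk, ‖(p : ℂ × ℂ).1‖ < 1 → ‖(p : ℂ × ℂ).2‖ < 1 →
    HasSum (fun mn : ℕ × ℕ => a mn.1 mn.2 * (p : ℂ × ℂ).1 ^ mn.1 * (p : ℂ × ℂ).2 ^ mn.2) (g p)

/-- Membership in the bidisk algebra `A(𝔻²)`: a continuous function on the closed bidisk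
which is given by a convergent two-variable power series on the open bidisk. -/
def memBidisk (f : C(Bidisk, ℂ)) : Prop := ∃ a : ℕ → ℕ → ℂ, HasCoeffsAt (⇑f) a

/-- Membership in `A_k(𝔻²)`: member of the bidisk algebra whose power series coefficients
`a m n` vanish whenever `k` does not divide `m + n`. -/
def memAk (k : ℕ) (f : C(Bidisk, ℂ)) : Prop :=
  ∃ a : ℕ → ℕ → ℂ, HasCoeffsAt (⇑f) a ∧ ∀ m n : ℕ, ¬ k ∣ (m + n) → a m n = 0

/-- `J` is a (two-sided) ideal of the subring of `R` with carrier set `S`. -/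
def IsIdealIn {R : Type*} [Ring R] (S J : Set R) : Prop :=
  J ⊆ S ∧ (0 : R) ∈ J ∧ (∀ f ∈ J, ∀ g ∈ J, f + g ∈ J) ∧ (∀ f ∈ J, -f ∈ J) ∧
    ∀ f ∈ S, ∀ g ∈ J, f * g ∈ J ∧ g * f ∈ J

/-- `J` is a maximal proper ideal of the subring of `R` with carrier set `S`. -/
def IsMaxIdealIn {R : Type*} [Ring R] (S J : Set R) : Prop :=
  IsIdealIn S J ∧ J ≠ S ∧ ∀ J' : Set R, IsIdealIn S J' → J ⊆ J' → J' = J ∨ J' = S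

open MeasureTheory AddCircle Topology

/-- The monomial `z ^ m * w ^ n` on the closed bidisk. -/
def bidiskMonomial (m n : ℕ) : C(Bidisk, ℂ) where
  toFun p := (p : ℂ × ℂ).1 ^ m * (p : ℂ × ℂ).2 ^ n

lemma bidiskMonomial_apply (m n : ℕ) (p : Bidisk) :
    bidiskMonomial m n p = (p : ℂ × ℂ).1 ^ m * (p : ℂ × ℂ).2 ^ n := rfl

lemma bidiskMonomial_mul (m n m' n' : ℕ) :
    bidiskMonomial m n * bidiskMonomial m' n' = bidiskMonomial (m + m') (n + n') := by
  ext p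
  simp only [ContinuousMap.mul_apply, bidiskMonomial_apply]
  ring

lemma Bidisk.norm_fst_le (p : Bidisk) : ‖(p : ℂ × ℂ).1‖ ≤ 1 := by
  simpa using p.2.1

lemma Bidisk.norm_snd_le (p : Bidisk) : ‖(p : ℂ × ℂ).2‖ ≤ 1 := by
  simpa using p.2.2

lemma Bidisk.mem_iff {p : ℂ × ℂ} : p ∈ Bidisk ↔ ‖p.1‖ ≤ 1 ∧ ‖p.2‖ ≤ 1 := by
  simp [Bidisk]

lemma norm_bidiskMonomial_le (m n : ℕ) : ‖bidiskMonomial m n‖ ≤ 1 := by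
  refine (ContinuousMap.norm_le _ zero_le_one).2 fun p => ?_
  rw [bidiskMonomial_apply, norm_mul, norm_pow, norm_pow]
  exact mul_le_one₀ (pow_le_one₀ (norm_nonneg _) (Bidisk.norm_fst_le p)) (by positivity)
    (pow_le_one₀ (norm_nonneg _) (Bidisk.norm_snd_le p))

/-- The monomials whose total degree is divisible by `k`. -/
def bidiskMonomials (k : ℕ) : Submonoid C(Bidisk, ℂ) where
  carrier := {f | ∃ m n : ℕ, k ∣ m + n ∧ bidiskMonomial m n = f}
  one_mem' := ⟨0, 0, by simp, by ext p; simp [bidiskMonomial_apply]⟩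
  mul_mem' := by
    rintro _ _ ⟨m, n, h, rfl⟩ ⟨m', n', h', rfl⟩
    refine ⟨m + m', n + n', ?_, (bidiskMonomial_mul _ _ _ _).symm⟩
    rw [add_add_add_comm]
    exact dvd_add h h'

/-- The polynomials all of whose monomials have total degree divisible by `k`. -/
def bidiskPolynomials (k : ℕ) : Subalgebra ℂ C(Bidisk, ℂ) :=
  Algebra.adjoin ℂ (bidiskMonomials k)

lemma bidiskPolynomials_toSubmodule (k : ℕ) :
    Subalgebra.toSubmodule (bidiskPolynomials k) =
      Submodule.span ℂ (bidiskMonomials k : Set C(Bidisk, ℂ)) := by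
  rw [bidiskPolynomials, Algebra.adjoin_eq_span, Submonoid.closure_eq]

lemma bidiskMonomial_mem_topologicalClosure {k m n : ℕ} (h : k ∣ m + n) :
    bidiskMonomial m n ∈ (bidiskPolynomials k).topologicalClosure :=
  Subalgebra.le_topologicalClosure _ (Algebra.subset_adjoin ⟨m, n, h, rfl⟩)

/-- The parametrization of the distinguished boundary of the bidisk. -/
def torusPoint : C(UnitAddCircle × UnitAddCircle, Bidisk) where
  toFun x := ⟨(fourier 1 x.1, fourier 1 x.2), by
    rw [Bidisk.mem_iff, fourier_one, fourier_one]
    exact ⟨(Circle.norm_coe _).le, (Circle.norm_coe _).le⟩⟩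

lemma integral_fourier_haar (n : ℤ) :
    ∫ x : UnitAddCircle, fourier n x ∂haarAddCircle = if n = 0 then 1 else 0 := by
  split_ifs with h
  · simp [h]
  · exact integral_eq_zero_of_add_right_eq_neg (μ := haarAddCircle)
      (fourier_add_half_inv_index h Fact.out)

lemma fourier_one_pow (m : ℕ) (x : UnitAddCircle) : (fourier 1 x) ^ m = fourier (m : ℤ) x := by
  induction m with
  | zero => simp
  | succ m ih => rw [pow_succ, ih, Nat.cast_succ, fourier_add]

/-- The `(m, n)`-th Fourier coefficient of the restriction of `f` to the torus. -/
def torusCoeff (m n : ℕ) : C(Bidisk, ℂ) →L[ℂ] ℂ :=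
  LinearMap.mkContinuous
    { toFun := fun f => ∫ x : UnitAddCircle × UnitAddCircle,
        fourier (-(m : ℤ)) x.1 * fourier (-(n : ℤ)) x.2 * f (torusPoint x)
          ∂(haarAddCircle.prod haarAddCircle)
      map_add' := fun f g => by
        rw [← integral_add]
        · simp only [ContinuousMap.add_apply, mul_add]
        all_goals
          exact Continuous.integrable_of_hasCompactSupport (by fun_prop)
            (HasCompactSupport.of_compactSpace _)
      map_smul' := fun c f => by
        simp only [ContinuousMap.smul_apply, mul_smul_comm, RingHom.id_apply]
        exact integral_smul c _ } 1 fun f => by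
    have h : ∀ᵐ x ∂((haarAddCircle (T := (1 : ℝ))).prod (haarAddCircle (T := (1 : ℝ)))),
        ‖fourier (-(m : ℤ)) x.1 * fourier (-(n : ℤ)) x.2 * f (torusPoint x)‖ ≤ ‖f‖ := by
      refine Filter.Eventually.of_forall fun x => ?_
      rw [norm_mul, norm_mul, fourier_apply, fourier_apply, Circle.norm_coe, Circle.norm_coe,
        one_mul, one_mul]
      exact f.norm_coe_le_norm _
    simpa using norm_integral_le_of_norm_le_const h

lemma norm_torusCoeff_le (m n : ℕ) : ‖torusCoeff m n‖ ≤ 1 :=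
  LinearMap.mkContinuous_norm_le _ zero_le_one _

lemma torusCoeff_bidiskMonomial (m n a b : ℕ) :
    torusCoeff m n (bidiskMonomial a b) = if (a, b) = (m, n) then 1 else 0 := by
  have h : torusCoeff m n (bidiskMonomial a b) = ∫ x : UnitAddCircle × UnitAddCircle,
      fourier ((a : ℤ) + -(m : ℤ)) x.1 * fourier ((b : ℤ) + -(n : ℤ)) x.2
        ∂(haarAddCircle.prod haarAddCircle) := by
    refine integral_congr_ae (Filter.Eventually.of_forall fun x => ?_)
    change fourier (-(m : ℤ)) x.1 * fourier (-(n : ℤ)) x.2 *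
      ((fourier 1 x.1) ^ a * (fourier 1 x.2) ^ b) = _
    simp only [fourier_one_pow, fourier_add]
    ring
  rw [h, integral_prod_mul (fun x => fourier ((a : ℤ) + -(m : ℤ)) x)
    (fun x => fourier ((b : ℤ) + -(n : ℤ)) x), integral_fourier_haar, integral_fourier_haar]
  have h₁ : (a : ℤ) + -(m : ℤ) = 0 ↔ a = m := by omega
  have h₂ : (b : ℤ) + -(n : ℤ) = 0 ↔ b = n := by omega
  simp only [h₁, h₂, Prod.mk.injEq, ite_and]
  split_ifs <;> simp

lemma memAk_of_mem_topologicalClosure {k : ℕ} {f : C(Bidisk, ℂ)}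
    (hf : f ∈ (bidiskPolynomials k).topologicalClosure) : memAk k f := by
  have hf' : f ∈ (Submodule.span ℂ (bidiskMonomials k : Set C(Bidisk, ℂ))).topologicalClosure := by
    rw [← bidiskPolynomials_toSubmodule]
    exact hf
  refine ⟨fun m n => torusCoeff m n f, fun p hz hw => ?_, fun m n hmn => ?_⟩
  · set z := (p : ℂ × ℂ).1
    set w := (p : ℂ × ℂ).2
    have hs : Summable fun mn : ℕ × ℕ => (z ^ mn.1 * w ^ mn.2) • torusCoeff mn.1 mn.2 := by
      refine Summable.of_norm_bounded (g := fun mn : ℕ × ℕ => ‖z‖ ^ mn.1 * ‖w‖ ^ mn.2)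
        ((summable_geometric_of_lt_one (norm_nonneg _) hz).mul_of_nonneg
          (summable_geometric_of_lt_one (norm_nonneg _) hw) (fun _ => by positivity)
          (fun _ => by positivity)) fun mn => ?_
      rw [norm_smul, norm_mul, norm_pow, norm_pow]
      exact mul_le_of_le_one_right (by positivity) (norm_torusCoeff_le _ _)
    have key (g : C(Bidisk, ℂ)) := hs.hasSum.mapL (ContinuousLinearMap.apply ℂ ℂ g)
    simp only [ContinuousLinearMap.apply_apply, smul_apply, smul_eq_mul] at key
    set L := ∑' mn : ℕ × ℕ, (z ^ mn.1 * w ^ mn.2) • torusCoeff mn.1 mn.2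
    have hL : L f = ContinuousMap.evalCLM ℂ p f := by
      refine (ContinuousLinearMap.eqOn_closure_span (f := L) (g := ContinuousMap.evalCLM ℂ p) ?_) hf'
      rintro _ ⟨a, b, -, rfl⟩
      refine (key _).unique ?_
      refine (hasSum_ite_eq (a, b) (z ^ a * w ^ b)).congr_fun fun mn => ?_
      rw [torusCoeff_bidiskMonomial]
      by_cases h : mn = (a, b)
      · subst h; simp
      · simp [h, Ne.symm h]
    have := key f
    rw [hL] at this
    refine this.congr_fun fun mn => ?_
    ring
  · have : torusCoeff m n f = (0 : C(Bidisk, ℂ) →L[ℂ] ℂ) f := by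
      refine (ContinuousLinearMap.eqOn_closure_span (f := torusCoeff m n) (g := 0) ?_) hf'
      rintro _ ⟨a, b, hab, rfl⟩
      rw [torusCoeff_bidiskMonomial, if_neg]
      · rfl
      · rintro ⟨⟩
        exact hmn hab
    simpa using this

/-- The contractions `(r, p) ↦ r • p` of the closed bidisk. -/
def bidiskDilation : C(unitInterval × Bidisk, Bidisk) where
  toFun x := ⟨((x.1 : ℝ) * (x.2 : ℂ × ℂ).1, (x.1 : ℝ) * (x.2 : ℂ × ℂ).2), by
    have h : ‖((x.1 : ℝ) : ℂ)‖ ≤ 1 := by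
      rw [Complex.norm_real, Real.norm_of_nonneg x.1.2.1]
      exact x.1.2.2
    rw [Bidisk.mem_iff, norm_mul, norm_mul]
    exact ⟨mul_le_one₀ h (norm_nonneg _) (Bidisk.norm_fst_le x.2),
      mul_le_one₀ h (norm_nonneg _) (Bidisk.norm_snd_le x.2)⟩⟩

lemma curry_dilation_mem {k : ℕ} {f : C(Bidisk, ℂ)} (hf : memAk k f) {r : unitInterval}
    (hr : r < 1) :
    (f.comp bidiskDilation).curry r ∈ (bidiskPolynomials k).topologicalClosure := by
  obtain ⟨a, ha, hk⟩ := hf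
  have hr0 : (0 : ℝ) ≤ r := r.2.1
  have hr1 : (r : ℝ) < 1 := hr
  have hn : ‖((r : ℝ) : ℂ)‖ = r := by rw [Complex.norm_real, Real.norm_of_nonneg hr0]
  have hs := (ha ⟨(((r : ℝ) : ℂ), ((r : ℝ) : ℂ)), by
    rw [Bidisk.mem_iff]; simp only [hn]; exact ⟨hr1.le, hr1.le⟩⟩
    (by rw [hn]; exact hr1) (by rw [hn]; exact hr1)).summable.norm
  have hS : Summable fun mn : ℕ × ℕ =>
      (a mn.1 mn.2 * ((r : ℝ) : ℂ) ^ mn.1 * ((r : ℝ) : ℂ) ^ mn.2) •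
        bidiskMonomial mn.1 mn.2 := by
    refine Summable.of_norm_bounded hs fun mn => ?_
    rw [norm_smul]
    exact mul_le_of_le_one_right (norm_nonneg _) (norm_bidiskMonomial_le _ _)
  have hE : (f.comp bidiskDilation).curry r = ∑' mn : ℕ × ℕ,
      (a mn.1 mn.2 * ((r : ℝ) : ℂ) ^ mn.1 * ((r : ℝ) : ℂ) ^ mn.2) •
        bidiskMonomial mn.1 mn.2 := by
    ext p
    have h₁ := hS.hasSum.mapL (ContinuousMap.evalCLM ℂ p)
    have hlt {z : ℂ} (hz : ‖z‖ ≤ 1) : ‖((r : ℝ) : ℂ) * z‖ < 1 := by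
      rw [norm_mul, hn]
      exact (mul_le_of_le_one_right hr0 hz).trans_lt hr1
    have h₂ := ha (bidiskDilation (r, p)) (hlt (Bidisk.norm_fst_le p)) (hlt (Bidisk.norm_snd_le p))
    refine h₂.unique ?_
    refine h₁.congr_fun fun mn => ?_
    change a mn.1 mn.2 * (((r : ℝ) : ℂ) * (p : ℂ × ℂ).1) ^ mn.1 *
      (((r : ℝ) : ℂ) * (p : ℂ × ℂ).2) ^ mn.2 =
      (a mn.1 mn.2 * ((r : ℝ) : ℂ) ^ mn.1 * ((r : ℝ) : ℂ) ^ mn.2) *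
        ((p : ℂ × ℂ).1 ^ mn.1 * (p : ℂ × ℂ).2 ^ mn.2)
    ring
  rw [hE]
  refine (bidiskPolynomials k).isClosed_topologicalClosure.mem_of_tendsto hS.hasSum
    (Filter.Eventually.of_forall fun s =>
      Subalgebra.sum_mem (bidiskPolynomials k).topologicalClosure fun mn _ => ?_)
  by_cases h : k ∣ mn.1 + mn.2
  · exact Subalgebra.smul_mem _ (bidiskMonomial_mem_topologicalClosure h) _
  · simp [hk _ _ h]

lemma memAk_iff_mem_topologicalClosure {k : ℕ} {f : C(Bidisk, ℂ)} :
    memAk k f ↔ f ∈ (bidiskPolynomials k).topologicalClosure := by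
  refine ⟨fun hf => ?_, memAk_of_mem_topologicalClosure⟩
  have h1 : (f.comp bidiskDilation).curry 1 = f := by
    ext p
    change f (bidiskDilation (1, p)) = f p
    congr 1
    ext <;> simp [bidiskDilation]
  rw [← h1]
  have : (𝓝[<] (1 : unitInterval)).NeBot := nhdsLT_neBot_of_exists_lt ⟨0, zero_lt_one⟩
  refine (bidiskPolynomials k).isClosed_topologicalClosure.mem_of_tendsto
    (b := 𝓝[<] (1 : unitInterval))
    (((f.comp bidiskDilation).curry.continuous.tendsto 1).mono_left nhdsWithin_le_nhds)
    (Filter.eventually_of_mem self_mem_nhdsWithin fun r hr => curry_dilation_mem hf hr)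

/-- Every multiplicative function on the pairs `(m, n)` with `k ∣ m + n` has the form
`(m, n) ↦ z ^ m * w ^ n`. -/
lemma exists_eq_pow_mul_pow {k : ℕ} (hk : 1 ≤ k) (χ : ℕ → ℕ → ℂ) (h0 : χ 0 0 = 1)
    (hχ : ∀ m n m' n', k ∣ m + n → k ∣ m' + n' → χ (m + m') (n + n') = χ m n * χ m' n') :
    ∃ z w : ℂ, ∀ m n, k ∣ m + n → χ m n = z ^ m * w ^ n := by
  have hpow (m n q : ℕ) (h : k ∣ m + n) : χ (m * q) (n * q) = χ m n ^ q := by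
    induction q with
    | zero => simpa using h0
    | succ q ih =>
      rw [mul_add_one, mul_add_one, hχ _ _ _ _ (by rw [← add_mul]; exact h.mul_right q) h, ih,
        pow_succ]
  have hk0 : k ≠ 0 := by omega
  obtain ⟨z, hz⟩ := IsAlgClosed.exists_pow_nat_eq (χ k 0) hk
  by_cases hc : χ k 0 = 0
  · obtain ⟨w, hw⟩ := IsAlgClosed.exists_pow_nat_eq (χ 0 k) hk
    refine ⟨0, w, fun m n hmn => ?_⟩
    rcases Nat.eq_zero_or_pos m with rfl | hm
    · obtain ⟨q, rfl⟩ : k ∣ n := by simpa using hmn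
      have := hpow 0 k q (by simp)
      rw [zero_mul] at this
      rw [this, ← hw]
      ring
    · have h₁ := hpow m n k hmn
      have h₂ := hχ (k * m) 0 0 (k * n) (by simp) (by simp)
      have h₃ := hpow k 0 m (by simp)
      rw [zero_mul, hc, zero_pow hm.ne'] at h₃
      rw [h₃, zero_mul, zero_add, add_zero, mul_comm k m, mul_comm k n, h₁] at h₂
      rw [pow_eq_zero_iff hk0 |>.1 h₂, zero_pow hm.ne', zero_mul]
  · have hz0 : z ≠ 0 := by
      rintro rfl
      exact hc (by rw [← hz, zero_pow hk0])
    refine ⟨z, χ (k - 1) 1 / z ^ (k - 1), ?_⟩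
    rintro m n ⟨q, hq⟩
    have hk1 : k ∣ k - 1 + 1 := by rw [Nat.sub_add_cancel hk]
    have h₁ := hχ m n (k * n) 0 ⟨q, hq⟩ (by simp)
    have h₂ := hχ ((k - 1) * n) (1 * n) (k * q) 0
      (by rw [← add_mul]; exact hk1.mul_right n) (by simp)
    have h₃ := hpow k 0 n (by simp)
    have h₄ := hpow k 0 q (by simp)
    rw [zero_mul] at h₃ h₄
    have he : m + k * n = (k - 1) * n + k * q := by
      rw [← hq]
      obtain ⟨j, rfl⟩ := Nat.exists_eq_add_of_le' hk
      simp only [Nat.add_sub_cancel]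
      ring
    rw [hpow _ _ _ hk1, h₄, one_mul, add_zero, ← he] at h₂
    rw [add_zero, h₂, h₃, ← hz, ← pow_mul, ← pow_mul, ← hq] at h₁
    have hzk : z ^ (k * n) = z ^ ((k - 1) * n) * z ^ n := by
      rw [← pow_add]
      congr 1
      obtain ⟨j, rfl⟩ := Nat.exists_eq_add_of_le' hk
      simp only [Nat.add_sub_cancel]
      ring
    rw [hzk, pow_add] at h₁
    rw [div_pow, ← pow_mul]
    have := pow_ne_zero n hz0
    have := pow_ne_zero ((k - 1) * n) hz0
    field_simp
    apply mul_right_cancel₀ (pow_ne_zero n hz0)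
    linear_combination -h₁

instance (k : ℕ) : CompleteSpace (bidiskPolynomials k).topologicalClosure :=
  (bidiskPolynomials k).isClosed_topologicalClosure.completeSpace_coe

/-- Every continuous character of the closure of `bidiskPolynomials k` is a point evaluation. -/
lemma exists_forall_character_eq {k : ℕ} (hk : 1 ≤ k)
    (φ : WeakDual.characterSpace ℂ (bidiskPolynomials k).topologicalClosure) :
    ∃ p : Bidisk, ∀ f, φ f = (f : C(Bidisk, ℂ)) p := by
  obtain ⟨z, w, hzw⟩ := exists_eq_pow_mul_pow hk
    (fun m n => if h : k ∣ m + n then φ ⟨bidiskMonomial m n, bidiskMonomial_mem_topologicalClosure h⟩ else 0)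
    (by
      rw [dif_pos (by simp), ← map_one φ]
      congr 1
      ext p
      simp [bidiskMonomial_apply])
    (fun m n m' n' h h' => by
      rw [dif_pos h, dif_pos h', dif_pos (by rw [add_add_add_comm]; exact dvd_add h h'),
        ← map_mul]
      congr 1
      ext1
      exact (bidiskMonomial_mul _ _ _ _).symm)
  have hφ (m n : ℕ) (h : k ∣ m + n) :
      φ ⟨bidiskMonomial m n, bidiskMonomial_mem_topologicalClosure h⟩ = z ^ m * w ^ n := by
    rw [← hzw m n h, dif_pos h]
  have hle (m n : ℕ) (h : k ∣ m + n) : ‖z ^ m * w ^ n‖ ≤ 1 := by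
    rw [← hφ m n h]
    have h1 : ‖(1 : (bidiskPolynomials k).topologicalClosure)‖ ≤ 1 :=
      (ContinuousMap.norm_le (1 : C(Bidisk, ℂ)) zero_le_one).2 fun _ => norm_one.le
    exact (AlgHom.norm_apply_le_self_mul_norm_one φ _).trans
      (mul_le_one₀ (norm_bidiskMonomial_le m n) (norm_nonneg _) h1)
  have hk0 : k ≠ 0 := by omega
  have hz : ‖z‖ ≤ 1 := (pow_le_one_iff_of_nonneg (norm_nonneg _) hk0).1 (by
    simpa using hle k 0 (by simp))
  have hw : ‖w‖ ≤ 1 := (pow_le_one_iff_of_nonneg (norm_nonneg _) hk0).1 (by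
    simpa using hle 0 k (by simp))
  let p : Bidisk := ⟨(z, w), Bidisk.mem_iff.2 ⟨hz, hw⟩⟩
  refine ⟨p, fun f => ?_⟩
  have hpoly (g : C(Bidisk, ℂ)) (hg : g ∈ bidiskPolynomials k) :
      φ ⟨g, Subalgebra.le_topologicalClosure _ hg⟩ = g p := by
    induction hg using Algebra.adjoin_induction with
    | mem x hx =>
      obtain ⟨m, n, h, rfl⟩ := hx
      exact hφ m n h
    | algebraMap r => exact AlgHomClass.commutes φ r
    | add x y hx hy ihx ihy => rw [ContinuousMap.add_apply, ← ihx, ← ihy, ← map_add]; rfl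
    | mul x y hx hy ihx ihy => rw [ContinuousMap.mul_apply, ← ihx, ← ihy, ← map_mul]; rfl
  obtain ⟨g, hg, hgf⟩ := mem_closure_iff_seq_limit.1 f.2
  have h₁ : Filter.Tendsto (fun i => (⟨g i, Subalgebra.le_topologicalClosure _ (hg i)⟩ :
      (bidiskPolynomials k).topologicalClosure)) Filter.atTop (𝓝 f) :=
    tendsto_subtype_rng.2 hgf
  have h₂ := ((map_continuous φ).tendsto f).comp h₁
  have h₃ := ((continuous_eval_const p).tendsto (f : C(Bidisk, ℂ))).comp hgf
  refine tendsto_nhds_unique h₂ (h₃.congr fun i => ?_)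
  exact (hpoly (g i) (hg i)).symm

/-- An ideal of a subalgebra, given as a subset of the ambient ring, as an `Ideal`. -/
def IsIdealIn.toIdeal {A : Subalgebra ℂ C(Bidisk, ℂ)} {J : Set C(Bidisk, ℂ)}
    (hJ : IsIdealIn (A : Set C(Bidisk, ℂ)) J) : Ideal A where
  carrier := {f | (f : C(Bidisk, ℂ)) ∈ J}
  zero_mem' := hJ.2.1
  add_mem' hf hg := hJ.2.2.1 _ hf _ hg
  smul_mem' c _ hf := (hJ.2.2.2.2 _ c.2 _ hf).1

/-- every maximal ideal of `A_k(𝔻²)` is of the form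
`N_{λ,μ} = {f ∈ A_k(𝔻²) : f(λ,μ) = 0}` for some point `(λ,μ)` of the closed bidisk. -/
theorem stmt2 (k : ℕ) (hk : 1 ≤ k) (J : Set C(Bidisk, ℂ))
    (hJ : IsMaxIdealIn {f : C(Bidisk, ℂ) | memAk k f} J) :
    ∃ p : Bidisk, J = {f : C(Bidisk, ℂ) | memAk k f ∧ f p = 0} := by
  have hA : {f : C(Bidisk, ℂ) | memAk k f} = (bidiskPolynomials k).topologicalClosure :=
    Set.ext fun _ => memAk_iff_mem_topologicalClosure
  rw [hA] at hJ
  obtain ⟨hid, hne, hmax⟩ := hJ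
  obtain ⟨M, hM, hIM⟩ := hid.toIdeal.exists_le_maximal fun h => hne <|
    hid.1.antisymm fun f hf => by
      have : (⟨f, hf⟩ : (bidiskPolynomials k).topologicalClosure) ∈ hid.toIdeal := by
        rw [h]; trivial
      exact this
  obtain ⟨p, hp⟩ := exists_forall_character_eq hk M.toCharacterSpace
  refine ⟨p, ?_⟩
  simp only [memAk_iff_mem_topologicalClosure]
  refine ((hmax {f | f ∈ (bidiskPolynomials k).topologicalClosure ∧ f p = 0} ?_ ?_).resolve_right
    fun h => ?_).symm
  · refine ⟨fun f hf => hf.1, ⟨zero_mem _, rfl⟩, fun f hf g hg => ⟨add_mem hf.1 hg.1, ?_⟩,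
      fun f hf => ⟨neg_mem hf.1, ?_⟩,
      fun f hf g hg => ⟨⟨mul_mem hf hg.1, ?_⟩, ⟨mul_mem hg.1 hf, ?_⟩⟩⟩
    · simp [hf.2, hg.2]
    · simp [hf.2]
    · simp [hg.2]
    · simp [hg.2]
  · intro f hf
    refine ⟨hid.1 hf, ?_⟩
    rw [← hp ⟨f, hid.1 hf⟩]
    exact M.toCharacterSpace_apply_eq_zero_of_mem (hIM hf)
  · have h1 : (1 : C(Bidisk, ℂ)) ∈
        {f | f ∈ (bidiskPolynomials k).topologicalClosure ∧ f p = 0} := by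
      rw [h]
      exact one_mem _
    exact one_ne_zero h1.2
end
end

section
/- Let k, ℓ ≥ 1. Each of the following maps on T_{k,ℓ} is a surjective unital ℂ-algebra homomorphism, so that its kernel is a maximal proper two-sided ideal of T_{k,ℓ}: (a) for 0 ≤ i₀ ≤ k−1 and 0 ≤ i₀' ≤ ℓ−1, ψ₀₀^{i₀ i₀'} : T_{k,ℓ} → ℂ, F ↦ f_{(i₀,i₀'),(i₀,i₀')}(0,0); (b) for 0 ≤ i₀ ≤ k−1 and μ in the closed unit disk with μ ≠ 0, ψ_{0μ}^{i₀} : T_{k,ℓ} → M_ℓ(ℂ), F ↦ (f_{(i₀,i'),(i₀,j')}(0,μ))_{i',j'=0}^{ℓ−1}; (c) for 0 ≤ i₀' ≤ ℓ−1 and λ in the closed unit disk with λ ≠ 0, ψ_{λ0}^{i₀'} : T_{k,ℓ} → M_k(ℂ), F ↦ (f_{(i,i₀'),(j,i₀')}(λ,0))_{i,j=0}^{k−1}; (d) for λ, μ in the closed unit disk both nonzero, ψ_{λμ} : T_{k,ℓ} → M_{kℓ}(ℂ), F ↦ F(λ,μ). -/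
noncomputable section

/-- The point `(0,0)` of the closed bidisk. -/
def pt0 : Bidisk := ⟨(0, 0), by simp [Bidisk]⟩

/-- The ambient algebra of continuous `M_{kℓ}(ℂ)`-valued functions on the closed bidisk,
with entries indexed by pairs `(i,i')`, `(j,j')`, `0 ≤ i,j ≤ k-1`, `0 ≤ i',j' ≤ ℓ-1`. -/
abbrev TM (k l : ℕ) := C(Bidisk, Matrix (Fin k × Fin l) (Fin k × Fin l) ℂ)

/-- Membership in `T_{k,ℓ}` (the concrete realization of `B_k ⊗̂ B_ℓ`): the power series
coefficients `a m n` of the entry `f_{(i,i'),(j,j')}` vanish unless `m ≡ i - j (mod k)`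
and `n ≡ i' - j' (mod ℓ)`. -/
def memT (k l : ℕ) (F : TM k l) : Prop :=
  ∀ (i j : Fin k) (i' j' : Fin l), ∃ a : ℕ → ℕ → ℂ,
    HasCoeffsAt (fun p => F p (i, i') (j, j')) a ∧
    ∀ m n : ℕ, ¬ (Int.ModEq (k : ℤ) (m : ℤ) ((i : ℤ) - (j : ℤ)) ∧
      Int.ModEq (l : ℤ) (n : ℤ) ((i' : ℤ) - (j' : ℤ))) → a m n = 0

/-- The functional `ψ₀₀^{i₀i₀'} : F ↦ f_{(i₀,i₀'),(i₀,i₀')}(0,0)`. -/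
def psiA (k l : ℕ) (i₀ : Fin k) (i₀' : Fin l) (F : TM k l) : ℂ := F pt0 (i₀, i₀') (i₀, i₀')

/-- The map `ψ_{0μ}^{i₀} : F ↦ (f_{(i₀,i'),(i₀,j')}(0,μ))_{i',j'}` into `M_ℓ(ℂ)`. -/
def psiB (k l : ℕ) (i₀ : Fin k) (p : Bidisk) (F : TM k l) : Matrix (Fin l) (Fin l) ℂ :=
  Matrix.of fun i' j' => F p (i₀, i') (i₀, j')

/-- The map `ψ_{λ0}^{i₀'} : F ↦ (f_{(i,i₀'),(j,i₀')}(λ,0))_{i,j}` into `M_k(ℂ)`. -/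
def psiC (k l : ℕ) (i₀' : Fin l) (p : Bidisk) (F : TM k l) : Matrix (Fin k) (Fin k) ℂ :=
  Matrix.of fun i j => F p (i, i₀') (j, i₀')

/-- The evaluation map `ψ_{λμ} : F ↦ F(λ,μ)` into `M_{kℓ}(ℂ)`. -/
def psiD (k l : ℕ) (p : Bidisk) (F : TM k l) : Matrix (Fin k × Fin l) (Fin k × Fin l) ℂ := F p

theorem IsMaxIdealIn.ker {R M : Type*} [Ring R] [Ring M] [IsSimpleRing M] (S : Subring R)
    (φ : R → M) (one : φ 1 = 1) (add : ∀ f ∈ S, ∀ g ∈ S, φ (f + g) = φ f + φ g)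
    (mul : ∀ f ∈ S, ∀ g ∈ S, φ (f * g) = φ f * φ g) (surj : ∀ c, ∃ f ∈ S, φ f = c) :
    IsMaxIdealIn (S : Set R) {f | f ∈ S ∧ φ f = 0} := by
  have zero : φ 0 = 0 := by simpa using add 0 S.zero_mem 0 S.zero_mem
  have neg : ∀ f ∈ S, φ (-f) = -φ f := fun f hf => by
    have h := add f hf (-f) (S.neg_mem hf)
    rw [add_neg_cancel, zero] at h
    exact (neg_eq_of_add_eq_zero_right h.symm).symm
  refine ⟨⟨fun f hf => hf.1, ⟨S.zero_mem, zero⟩, ?_, ?_, ?_⟩, ?_, ?_⟩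
  · rintro f ⟨hf, hf0⟩ g ⟨hg, hg0⟩
    exact ⟨S.add_mem hf hg, by rw [add f hf g hg, hf0, hg0, add_zero]⟩
  · rintro f ⟨hf, hf0⟩
    exact ⟨S.neg_mem hf, by rw [neg f hf, hf0, neg_zero]⟩
  · rintro f hf g ⟨hg, hg0⟩
    exact ⟨⟨S.mul_mem hf hg, by rw [mul f hf g hg, hg0, mul_zero]⟩,
      ⟨S.mul_mem hg hf, by rw [mul g hg f hf, hg0, zero_mul]⟩⟩
  · intro h
    have h1 : (1 : R) ∈ {f | f ∈ S ∧ φ f = 0} := h ▸ S.one_mem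
    exact one_ne_zero (one.symm.trans h1.2)
  · rintro J' ⟨hS, h0, hadd, hneg, hmul⟩ hJ
    let I : TwoSidedIdeal M := TwoSidedIdeal.mk' (φ '' J') ⟨0, h0, zero⟩
      (by
        rintro _ _ ⟨f, hf, rfl⟩ ⟨g, hg, rfl⟩
        exact ⟨f + g, hadd f hf g hg, add f (hS hf) g (hS hg)⟩)
      (by
        rintro _ ⟨f, hf, rfl⟩
        exact ⟨-f, hneg f hf, neg f (hS hf)⟩)
      (by
        rintro x _ ⟨g, hg, rfl⟩
        obtain ⟨f, hf, rfl⟩ := surj x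
        exact ⟨f * g, (hmul f hf g hg).1, mul f hf g (hS hg)⟩)
      (by
        rintro _ x ⟨g, hg, rfl⟩
        obtain ⟨f, hf, rfl⟩ := surj x
        exact ⟨g * f, (hmul f hf g hg).2, mul g (hS hg) f hf⟩)
    have hI : ∀ x, x ∈ I ↔ x ∈ φ '' J' := fun x => TwoSidedIdeal.mem_mk' _ _ _ _ _ _ x
    rcases eq_bot_or_eq_top I with h | h
    · left
      refine Set.Subset.antisymm (fun f hf => ⟨hS hf, ?_⟩) hJ
      have : φ f ∈ I := (hI _).2 ⟨f, hf, rfl⟩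
      rwa [h, TwoSidedIdeal.mem_bot] at this
    · right
      have h1 : (1 : M) ∈ I := h ▸ TwoSidedIdeal.mem_top M
      obtain ⟨g, hg, hg1⟩ := (hI _).1 h1
      have hker : 1 + -g ∈ J' := hJ ⟨S.add_mem S.one_mem (S.neg_mem (hS hg)), by
        rw [add 1 S.one_mem _ (S.neg_mem (hS hg)), neg g (hS hg), one, hg1, add_neg_cancel]⟩
      have hone : (1 : R) ∈ J' := by simpa using hadd _ hker _ hg
      exact Set.Subset.antisymm hS fun f hf => by simpa using (hmul f hf 1 hone).1

theorem HasCoeffsAt.add {f g : Bidisk → ℂ} {a b : ℕ → ℕ → ℂ} (hf : HasCoeffsAt f a)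
    (hg : HasCoeffsAt g b) : HasCoeffsAt (fun p => f p + g p) (a + b) := fun p h1 h2 => by
  simpa [add_mul] using (hf p h1 h2).add (hg p h1 h2)

theorem HasCoeffsAt.sum {ι : Type*} (s : Finset ι) {f : ι → Bidisk → ℂ} {a : ι → ℕ → ℕ → ℂ}
    (h : ∀ i ∈ s, HasCoeffsAt (f i) (a i)) :
    HasCoeffsAt (fun p => ∑ i ∈ s, f i p) (fun m n => ∑ i ∈ s, a i m n) := fun p h1 h2 => by
  simpa [Finset.sum_mul] using hasSum_sum fun i hi => h i hi p h1 h2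

theorem HasCoeffsAt.const_mul {f : Bidisk → ℂ} {a : ℕ → ℕ → ℂ} (c : ℂ) (hf : HasCoeffsAt f a) :
    HasCoeffsAt (fun p => c * f p) (fun m n => c * a m n) := fun p h1 h2 => by
  simpa [mul_assoc] using (hf p h1 h2).mul_left c

/-- The coefficients of the Cauchy product of two double power series. -/
def mulCoeff (a b : ℕ → ℕ → ℂ) (m n : ℕ) : ℂ :=
  ∑' x : (fun x : (ℕ × ℕ) × (ℕ × ℕ) => x.1 + x.2) ⁻¹' {(m, n)},
    a x.1.1.1 x.1.1.2 * b x.1.2.1 x.1.2.2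

theorem HasCoeffsAt.mul {f g : Bidisk → ℂ} {a b : ℕ → ℕ → ℂ} (hf : HasCoeffsAt f a)
    (hg : HasCoeffsAt g b) : HasCoeffsAt (fun p => f p * g p) (mulCoeff a b) := by
  intro p h1 h2
  have hs := summable_mul_of_summable_norm (hf p h1 h2).summable.norm (hg p h1 h2).summable.norm
  have h := ((hf p h1 h2).mul (hg p h1 h2) hs).tsum_fiberwise
    (fun x : (ℕ × ℕ) × (ℕ × ℕ) => x.1 + x.2)
  refine h.congr_fun ?_
  rintro ⟨m, n⟩
  rw [mulCoeff, mul_assoc, ← tsum_mul_right]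
  refine tsum_congr ?_
  rintro ⟨⟨⟨m₁, n₁⟩, ⟨m₂, n₂⟩⟩, hx⟩
  obtain ⟨rfl, rfl⟩ : m₁ + m₂ = m ∧ n₁ + n₂ = n := by simpa using hx
  simp only [pow_add]
  ring

theorem HasCoeffsAt.monomial (c : ℂ) (d e : ℕ) :
    HasCoeffsAt (fun p => c * (p : ℂ × ℂ).1 ^ d * (p : ℂ × ℂ).2 ^ e)
      (fun m n => if m = d ∧ n = e then c else 0) := fun p _ _ => by
  convert hasSum_single (d, e) ?_ using 1
  · simp
  · rintro ⟨m, n⟩ h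
    have : ¬ (m = d ∧ n = e) := fun h' => h (Prod.ext h'.1 h'.2)
    simp [this]

section

variable {k l : ℕ}

theorem memT_monomials (C : Matrix (Fin k × Fin l) (Fin k × Fin l) ℂ)
    (d : Fin k → Fin k → ℕ) (e : Fin l → Fin l → ℕ)
    (h : ∀ i j i' j', C (i, i') (j, j') ≠ 0 →
      Int.ModEq (k : ℤ) (d i j : ℤ) ((i : ℤ) - (j : ℤ)) ∧
      Int.ModEq (l : ℤ) (e i' j' : ℤ) ((i' : ℤ) - (j' : ℤ))) :
    ∃ F : TM k l, memT k l F ∧ ∀ p I J,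
      F p I J = C I J * (p : ℂ × ℂ).1 ^ d I.1 J.1 * (p : ℂ × ℂ).2 ^ e I.2 J.2 := by
  refine ⟨⟨fun p => Matrix.of fun I J =>
    C I J * (p : ℂ × ℂ).1 ^ d I.1 J.1 * (p : ℂ × ℂ).2 ^ e I.2 J.2, ?_⟩, ?_, fun _ _ _ => rfl⟩
  · refine continuous_matrix fun I J => ?_
    simp only [Matrix.of_apply]
    fun_prop
  · intro i j i' j'
    refine ⟨_, HasCoeffsAt.monomial (C (i, i') (j, j')) (d i j) (e i' j'), ?_⟩
    rintro m n hmn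
    by_contra h0
    obtain ⟨⟨rfl, rfl⟩, hC⟩ := ite_ne_right_iff.1 h0
    exact hmn (h i j i' j' hC)

theorem memT_one : memT k l 1 := by
  obtain ⟨F, hF, h⟩ := memT_monomials (k := k) (l := l) 1 (fun _ _ => 0) (fun _ _ => 0)
    (fun i j i' j' hC => by
      obtain ⟨rfl, rfl⟩ : i = j ∧ i' = j' := by
        by_contra hne
        exact hC (Matrix.one_apply_ne fun h => hne (by simpa using h))
      simp [Int.ModEq.refl])
  convert hF
  ext p I J
  simp [h]

theorem memT.add {F G : TM k l} (hF : memT k l F) (hG : memT k l G) : memT k l (F + G) := by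
  intro i j i' j'
  obtain ⟨a, ha, ha0⟩ := hF i j i' j'
  obtain ⟨b, hb, hb0⟩ := hG i j i' j'
  exact ⟨_, ha.add hb, fun m n h => by simp [ha0 m n h, hb0 m n h]⟩

theorem memT.smul {F : TM k l} (c : ℂ) (hF : memT k l F) : memT k l (c • F) := by
  intro i j i' j'
  obtain ⟨a, ha, ha0⟩ := hF i j i' j'
  exact ⟨_, ha.const_mul c, fun m n h => by simp [ha0 m n h]⟩

theorem memT.mul {F G : TM k l} (hF : memT k l F) (hG : memT k l G) : memT k l (F * G) := by
  intro i j i' j'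
  choose a ha ha0 using hF
  choose b hb hb0 using hG
  have h := HasCoeffsAt.sum (Finset.univ : Finset (Fin k × Fin l)) fun s _ =>
    (ha i s.1 i' s.2).mul (hb s.1 j s.2 j')
  refine ⟨_, h, fun m n hmn => Finset.sum_eq_zero fun s _ => ?_⟩
  refine (tsum_congr fun x => ?_).trans tsum_zero
  obtain ⟨⟨⟨m₁, n₁⟩, ⟨m₂, n₂⟩⟩, hx⟩ := x
  obtain ⟨rfl, rfl⟩ : m₁ + m₂ = m ∧ n₁ + n₂ = n := by simpa using hx
  by_contra hne
  obtain ⟨h1, h2⟩ := mul_ne_zero_iff.1 hne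
  have h1' := not_not.1 (mt (ha0 i s.1 i' s.2 m₁ n₁) h1)
  have h2' := not_not.1 (mt (hb0 s.1 j s.2 j' m₂ n₂) h2)
  refine hmn ⟨?_, ?_⟩
  · simpa using h1'.1.add h2'.1
  · simpa using h1'.2.add h2'.2

/-- `T_{k,ℓ}` as a subring of the ambient algebra. -/
def subringT (k l : ℕ) : Subring (TM k l) where
  carrier := {F | memT k l F}
  mul_mem' := memT.mul
  one_mem' := memT_one
  add_mem' := memT.add
  zero_mem' := zero_smul ℂ (1 : TM k l) ▸ memT_one.smul 0
  neg_mem' {F} h := neg_one_smul ℂ F ▸ memT.smul (-1) h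

/-- A continuous function on the closed bidisk vanishes at `p` if it vanishes on the points of
the open bidisk lying on the same coordinate axes as `p`. -/
theorem eq_zero_of_open_bidisk {g : Bidisk → ℂ} (hg : Continuous g) (p : Bidisk)
    (h : ∀ q : Bidisk, ‖(q : ℂ × ℂ).1‖ < 1 → ‖(q : ℂ × ℂ).2‖ < 1 →
      ((p : ℂ × ℂ).1 = 0 → (q : ℂ × ℂ).1 = 0) → ((p : ℂ × ℂ).2 = 0 → (q : ℂ × ℂ).2 = 0) →
      g q = 0) : g p = 0 := by
  obtain ⟨⟨z, w⟩, hp⟩ := p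
  have hz : ‖z‖ ≤ 1 := by simpa using hp.1
  have hw : ‖w‖ ≤ 1 := by simpa using hp.2
  let t : ℕ → ℂ := fun n => (n : ℂ) / (n + 1)
  have ht : Filter.Tendsto t Filter.atTop (nhds 1) := by
    simpa using tendsto_natCast_div_add_atTop (𝕜 := ℂ) 1
  have hlt : ∀ n x, ‖x‖ ≤ 1 → ‖t n * x‖ < 1 := fun n x hx => by
    have : ‖t n‖ < 1 := by
      have h1 : ‖((n : ℂ) + 1)‖ = (n : ℝ) + 1 := by
        rw [← Nat.cast_add_one, Complex.norm_natCast, Nat.cast_add_one]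
      rw [norm_div, h1, Complex.norm_natCast, div_lt_one (by positivity)]
      linarith
    rw [norm_mul]
    exact (mul_le_of_le_one_right (norm_nonneg _) hx).trans_lt this
  let q : ℕ → Bidisk := fun n => ⟨(t n * z, t n * w),
    by simpa using (hlt n z hz).le, by simpa using (hlt n w hw).le⟩
  have hq : Filter.Tendsto q Filter.atTop (nhds ⟨(z, w), hp⟩) := by
    rw [tendsto_subtype_rng]
    simpa using (ht.mul_const z).prodMk_nhds (ht.mul_const w)
  refine tendsto_nhds_unique ((hg.tendsto _).comp hq) ?_
  refine tendsto_const_nhds.congr fun n => (h (q n) (hlt n z hz) (hlt n w hw) ?_ ?_).symm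
  · intro h0
    simp only [] at h0
    simp [q, h0]
  · intro h0
    simp only [] at h0
    simp [q, h0]

theorem Fin.eq_of_zero_modEq {n : ℕ} {i j : Fin n} (h : Int.ModEq (n : ℤ) 0 ((i : ℤ) - (j : ℤ))) :
    i = j := by
  have h' := Int.eq_zero_of_abs_lt_dvd (Int.modEq_zero_iff_dvd.1 h.symm)
    (by rw [abs_lt]; constructor <;> omega)
  exact Fin.ext (by omega)

theorem memT.continuous_entry (F : TM k l) (I J : Fin k × Fin l) :
    Continuous fun p => F p I J := F.continuous.matrix_elem I J

theorem memT.apply_eq_zero_left {F : TM k l} (hF : memT k l F) {p : Bidisk}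
    (hp : (p : ℂ × ℂ).1 = 0) {i j : Fin k} (hij : i ≠ j) (i' j' : Fin l) :
    F p (i, i') (j, j') = 0 := by
  obtain ⟨a, ha, ha0⟩ := hF i j i' j'
  refine eq_zero_of_open_bidisk (memT.continuous_entry F (i, i') (j, j')) p
    fun q h1 h2 hq _ => (ha q h1 h2).unique (hasSum_zero.congr_fun ?_)
  rintro ⟨m, n⟩
  rcases eq_or_ne m 0 with rfl | hm
  · simp [ha0 0 n fun h => hij (Fin.eq_of_zero_modEq h.1)]
  · simp [hq hp, hm]

theorem memT.apply_eq_zero_right {F : TM k l} (hF : memT k l F) {p : Bidisk}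
    (hp : (p : ℂ × ℂ).2 = 0) (i j : Fin k) {i' j' : Fin l} (hij : i' ≠ j') :
    F p (i, i') (j, j') = 0 := by
  obtain ⟨a, ha, ha0⟩ := hF i j i' j'
  refine eq_zero_of_open_bidisk (memT.continuous_entry F (i, i') (j, j')) p
    fun q h1 h2 _ hq => (ha q h1 h2).unique (hasSum_zero.congr_fun ?_)
  rintro ⟨m, n⟩
  rcases eq_or_ne n 0 with rfl | hn
  · simp [ha0 m 0 fun h => hij (Fin.eq_of_zero_modEq h.2)]
  · simp [hq hp, hn]

theorem natCast_add_sub_modEq {n : ℕ} (i j : Fin n) :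
    Int.ModEq (n : ℤ) ((i + n - j : ℕ) : ℤ) ((i : ℤ) - (j : ℤ)) := by
  rw [Nat.cast_sub (by omega), Nat.cast_add, add_sub_right_comm]
  simp

theorem psiA_mul (i₀ : Fin k) (i₀' : Fin l) {F : TM k l} (hF : memT k l F) (G : TM k l) :
    psiA k l i₀ i₀' (F * G) = psiA k l i₀ i₀' F * psiA k l i₀ i₀' G := by
  refine (Matrix.mul_apply).trans (Finset.sum_eq_single (i₀, i₀') ?_ (by simp))
  rintro ⟨s, s'⟩ - hs
  rcases eq_or_ne i₀ s with rfl | h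
  · have : i₀' ≠ s' := fun h => hs (by rw [h])
    rw [hF.apply_eq_zero_right rfl _ _ this, zero_mul]
  · rw [hF.apply_eq_zero_left rfl h, zero_mul]

theorem psiB_mul (i₀ : Fin k) {p : Bidisk} (hp : (p : ℂ × ℂ).1 = 0) {F : TM k l}
    (hF : memT k l F) (G : TM k l) :
    psiB k l i₀ p (F * G) = psiB k l i₀ p F * psiB k l i₀ p G := by
  ext i' j'
  refine (Matrix.mul_apply).trans ((Fintype.sum_prod_type _).trans ?_)
  refine (Finset.sum_eq_single i₀ ?_ (by simp)).trans rfl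
  intro s _ hs
  exact Finset.sum_eq_zero fun s' _ => by
    rw [hF.apply_eq_zero_left hp hs.symm, zero_mul]

theorem psiC_mul (i₀' : Fin l) {p : Bidisk} (hp : (p : ℂ × ℂ).2 = 0) {F : TM k l}
    (hF : memT k l F) (G : TM k l) :
    psiC k l i₀' p (F * G) = psiC k l i₀' p F * psiC k l i₀' p G := by
  ext i j
  refine (Matrix.mul_apply).trans ((Fintype.sum_prod_type_right _).trans ?_)
  refine (Finset.sum_eq_single i₀' ?_ (by simp)).trans rfl
  intro s' _ hs
  exact Finset.sum_eq_zero fun s _ => by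
    rw [hF.apply_eq_zero_right hp _ _ hs.symm, zero_mul]

theorem psiA_surjective (i₀ : Fin k) (i₀' : Fin l) (c : ℂ) :
    ∃ F : TM k l, memT k l F ∧ psiA k l i₀ i₀' F = c :=
  ⟨c • 1, memT_one.smul c, by simp [psiA]⟩

theorem psiB_surjective (i₀ : Fin k) {p : Bidisk} (hp : (p : ℂ × ℂ).2 ≠ 0)
    (A : Matrix (Fin l) (Fin l) ℂ) : ∃ F : TM k l, memT k l F ∧ psiB k l i₀ p F = A := by
  obtain ⟨F, hF, h⟩ := memT_monomials (k := k) (l := l)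
    (Matrix.of fun I J => if I.1 = i₀ ∧ J.1 = i₀ then
      A I.2 J.2 / (p : ℂ × ℂ).2 ^ (I.2 + l - J.2 : ℕ) else 0)
    (fun _ _ => 0) (fun i' j' => i' + l - j') (fun i j i' j' hC => by
      obtain ⟨⟨rfl, rfl⟩, -⟩ := ite_ne_right_iff.1 hC
      exact ⟨by simp [Int.ModEq.refl], natCast_add_sub_modEq i' j'⟩)
  refine ⟨F, hF, ?_⟩
  ext i' j'
  simp [psiB, h, hp]

theorem psiC_surjective (i₀' : Fin l) {p : Bidisk} (hp : (p : ℂ × ℂ).1 ≠ 0)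
    (A : Matrix (Fin k) (Fin k) ℂ) : ∃ F : TM k l, memT k l F ∧ psiC k l i₀' p F = A := by
  obtain ⟨F, hF, h⟩ := memT_monomials (k := k) (l := l)
    (Matrix.of fun I J => if I.2 = i₀' ∧ J.2 = i₀' then
      A I.1 J.1 / (p : ℂ × ℂ).1 ^ (I.1 + k - J.1 : ℕ) else 0)
    (fun i j => i + k - j) (fun _ _ => 0) (fun i j i' j' hC => by
      obtain ⟨⟨rfl, rfl⟩, -⟩ := ite_ne_right_iff.1 hC
      exact ⟨natCast_add_sub_modEq i j, by simp [Int.ModEq.refl]⟩)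
  refine ⟨F, hF, ?_⟩
  ext i j
  simp [psiC, h, hp]

theorem psiD_surjective {p : Bidisk} (hp₁ : (p : ℂ × ℂ).1 ≠ 0) (hp₂ : (p : ℂ × ℂ).2 ≠ 0)
    (A : Matrix (Fin k × Fin l) (Fin k × Fin l) ℂ) :
    ∃ F : TM k l, memT k l F ∧ psiD k l p F = A := by
  obtain ⟨F, hF, h⟩ := memT_monomials (k := k) (l := l)
    (Matrix.of fun I J => A I J / (p : ℂ × ℂ).2 ^ (I.2 + l - J.2 : ℕ)
      / (p : ℂ × ℂ).1 ^ (I.1 + k - J.1 : ℕ))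
    (fun i j => i + k - j) (fun i' j' => i' + l - j')
    (fun i j i' j' _ => ⟨natCast_add_sub_modEq i j, natCast_add_sub_modEq i' j'⟩)
  refine ⟨F, hF, ?_⟩
  ext I J
  simp [psiD, h, hp₁, hp₂]

theorem psiB_one (i₀ : Fin k) (p : Bidisk) : psiB k l i₀ p 1 = 1 := by
  ext i' j'
  simp [psiB, Matrix.one_apply]

theorem psiC_one (i₀' : Fin l) (p : Bidisk) : psiC k l i₀' p 1 = 1 := by
  ext i j
  simp [psiC, Matrix.one_apply]

end

/-- each of the maps `ψ₀₀^{i₀i₀'}`, `ψ_{0μ}^{i₀}` (μ ≠ 0), `ψ_{λ0}^{i₀'}`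
(λ ≠ 0) and `ψ_{λμ}` (λ, μ ≠ 0) on `T_{k,ℓ}` is a surjective unital `ℂ`-algebra
homomorphism, and its kernel is a maximal proper two-sided ideal of `T_{k,ℓ}`. -/
theorem stmt11 (k l : ℕ) (hk : 1 ≤ k) (hl : 1 ≤ l) :
    (∀ (i₀ : Fin k) (i₀' : Fin l),
      psiA k l i₀ i₀' 1 = 1 ∧
      (∀ F G : TM k l, memT k l F → memT k l G →
        psiA k l i₀ i₀' (F + G) = psiA k l i₀ i₀' F + psiA k l i₀ i₀' G) ∧
      (∀ (c : ℂ) (F : TM k l), memT k l F →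
        psiA k l i₀ i₀' (c • F) = c * psiA k l i₀ i₀' F) ∧
      (∀ F G : TM k l, memT k l F → memT k l G →
        psiA k l i₀ i₀' (F * G) = psiA k l i₀ i₀' F * psiA k l i₀ i₀' G) ∧
      (∀ c : ℂ, ∃ F : TM k l, memT k l F ∧ psiA k l i₀ i₀' F = c) ∧
      IsMaxIdealIn {F : TM k l | memT k l F} {F : TM k l | memT k l F ∧ psiA k l i₀ i₀' F = 0}) ∧
    (∀ (i₀ : Fin k) (p : Bidisk), (p : ℂ × ℂ).1 = 0 → (p : ℂ × ℂ).2 ≠ 0 →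
      psiB k l i₀ p 1 = 1 ∧
      (∀ F G : TM k l, memT k l F → memT k l G →
        psiB k l i₀ p (F + G) = psiB k l i₀ p F + psiB k l i₀ p G) ∧
      (∀ (c : ℂ) (F : TM k l), memT k l F →
        psiB k l i₀ p (c • F) = c • psiB k l i₀ p F) ∧
      (∀ F G : TM k l, memT k l F → memT k l G →
        psiB k l i₀ p (F * G) = psiB k l i₀ p F * psiB k l i₀ p G) ∧
      (∀ A : Matrix (Fin l) (Fin l) ℂ, ∃ F : TM k l, memT k l F ∧ psiB k l i₀ p F = A) ∧
      IsMaxIdealIn {F : TM k l | memT k l F} {F : TM k l | memT k l F ∧ psiB k l i₀ p F = 0}) ∧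
    (∀ (i₀' : Fin l) (p : Bidisk), (p : ℂ × ℂ).1 ≠ 0 → (p : ℂ × ℂ).2 = 0 →
      psiC k l i₀' p 1 = 1 ∧
      (∀ F G : TM k l, memT k l F → memT k l G →
        psiC k l i₀' p (F + G) = psiC k l i₀' p F + psiC k l i₀' p G) ∧
      (∀ (c : ℂ) (F : TM k l), memT k l F →
        psiC k l i₀' p (c • F) = c • psiC k l i₀' p F) ∧
      (∀ F G : TM k l, memT k l F → memT k l G →
        psiC k l i₀' p (F * G) = psiC k l i₀' p F * psiC k l i₀' p G) ∧
      (∀ A : Matrix (Fin k) (Fin k) ℂ, ∃ F : TM k l, memT k l F ∧ psiC k l i₀' p F = A) ∧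
      IsMaxIdealIn {F : TM k l | memT k l F} {F : TM k l | memT k l F ∧ psiC k l i₀' p F = 0}) ∧
    (∀ p : Bidisk, (p : ℂ × ℂ).1 ≠ 0 → (p : ℂ × ℂ).2 ≠ 0 →
      psiD k l p 1 = 1 ∧
      (∀ F G : TM k l, memT k l F → memT k l G →
        psiD k l p (F + G) = psiD k l p F + psiD k l p G) ∧
      (∀ (c : ℂ) (F : TM k l), memT k l F →
        psiD k l p (c • F) = c • psiD k l p F) ∧
      (∀ F G : TM k l, memT k l F → memT k l G →
        psiD k l p (F * G) = psiD k l p F * psiD k l p G) ∧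
      (∀ A : Matrix (Fin k × Fin l) (Fin k × Fin l) ℂ,
        ∃ F : TM k l, memT k l F ∧ psiD k l p F = A) ∧
      IsMaxIdealIn {F : TM k l | memT k l F} {F : TM k l | memT k l F ∧ psiD k l p F = 0}) := by
  have : Nonempty (Fin k) := ⟨⟨0, hk⟩⟩
  have : Nonempty (Fin l) := ⟨⟨0, hl⟩⟩
  refine ⟨fun i₀ i₀' => ?_, fun i₀ p hp₁ hp₂ => ?_, fun i₀' p hp₁ hp₂ => ?_,
    fun p hp₁ hp₂ => ?_⟩
  · have one : psiA k l i₀ i₀' 1 = 1 := by simp [psiA]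
    exact ⟨one, fun _ _ _ _ => rfl, fun _ _ _ => rfl, fun _ G hF _ => psiA_mul i₀ i₀' hF G,
      psiA_surjective i₀ i₀', IsMaxIdealIn.ker (subringT k l) _ one (fun _ _ _ _ => rfl)
        (fun _ hF G _ => psiA_mul i₀ i₀' hF G) (psiA_surjective i₀ i₀')⟩
  · exact ⟨psiB_one i₀ p, fun _ _ _ _ => rfl, fun _ _ _ => rfl,
      fun _ G hF _ => psiB_mul i₀ hp₁ hF G, psiB_surjective i₀ hp₂,
      IsMaxIdealIn.ker (subringT k l) _ (psiB_one i₀ p) (fun _ _ _ _ => rfl)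
        (fun _ hF G _ => psiB_mul i₀ hp₁ hF G) (psiB_surjective i₀ hp₂)⟩
  · exact ⟨psiC_one i₀' p, fun _ _ _ _ => rfl, fun _ _ _ => rfl,
      fun _ G hF _ => psiC_mul i₀' hp₂ hF G, psiC_surjective i₀' hp₁,
      IsMaxIdealIn.ker (subringT k l) _ (psiC_one i₀' p) (fun _ _ _ _ => rfl)
        (fun _ hF G _ => psiC_mul i₀' hp₂ hF G) (psiC_surjective i₀' hp₁)⟩
  · exact ⟨rfl, fun _ _ _ _ => rfl, fun _ _ _ => rfl, fun _ _ _ _ => rfl,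
      psiD_surjective hp₁ hp₂,
      IsMaxIdealIn.ker (subringT k l) _ rfl (fun _ _ _ _ => rfl) (fun _ _ _ _ => rfl)
        (psiD_surjective hp₁ hp₂)⟩
end
end
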